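/- arXiv:1408.2643 — 2 statements merged into one kernel-verified Lean document; each statement's English description precedes it below -/
import Mathlib

section
/- Let A be a commutative Noetherian ring, let I be an ideal of A, and let s ∈ A be such that I + (s) = A. Let Q be a finitely generated projective A-module such that Q/IQ is a free A/I-module, and let P = Q ⊕ A². Let Φ : P → A be an A-linear map with Φ(P) = I, and let r be a positive integer. Then the map s^r·Φ : P → A induces a surjection of P/IP onto I/I². Moreover, if r is even, then there exists an A-linear map Ψ : P → A with Ψ(P) = I such that (Ψ − s^r·Φ)(P) ⊆ I². -/
open Polynomial TensorProduct

lemma krus {B : Type*} [CommRing B] (a α b c b' c' k : B) (h1 : a * α + k = 1)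
    (hk : k = b * b' + c * c') (hb : α * b + c' * k = 0) (hc : α * c - b' * k = 0) :
    b = 0 ∧ c = 0 := by
  have h2 : α * k = 0 := by rw [hk]; linear_combination b' * hb + c' * hc
  have h3 : k = k * k := by linear_combination (-k) * h1 + a * h2
  have h4 : c' * k = 0 := by linear_combination k * hb - b * h2 + c' * h3
  have h5 : b' * k = 0 := by linear_combination -k * hc + c * h2 + b' * h3
  have h6 : k = 0 := by
    rw [h3]; nth_rewrite 1 [hk]; linear_combination b * h5 + c * h4
  constructor
  · linear_combination (-b) * h1 + a * hb + (b - a * c') * h6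
  · linear_combination (-c) * h1 + a * hc + (c + a * b') * h6

/-- Endomorphisms of `P` along which surjections onto `I` can be twisted. -/
def GoodEnd {A : Type} [CommRing A] (I : Ideal A) {P : Type} [AddCommGroup P] [Module A P]
    (e : P → P) : Prop :=
  ∀ Φ : P →ₗ[A] A, LinearMap.range Φ = I →
    ∃ Ψ : P →ₗ[A] A, LinearMap.range Ψ = I ∧ ∀ x, Ψ x - Φ (e x) ∈ I ^ 2

section
variable {A : Type} [CommRing A] {I : Ideal A} {P : Type} [AddCommGroup P] [Module A P]

lemma map_smul_top_mem (Φ : P →ₗ[A] A) (hΦ : LinearMap.range Φ = I) (x : P)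
    (hx : x ∈ (I • ⊤ : Submodule A P)) : Φ x ∈ I ^ 2 := by
  have h : Φ x ∈ Submodule.map Φ (I • ⊤ : Submodule A P) := Submodule.mem_map_of_mem hx
  rw [Submodule.map_smul'', Submodule.map_top, hΦ] at h
  rw [pow_two]; exact h

lemma good_congr {e e' : P → P} (h : ∀ x, e x - e' x ∈ (I • ⊤ : Submodule A P))
    (he : GoodEnd I e) : GoodEnd I e' := by
  intro Φ hΦ
  obtain ⟨Ψ, h1, h2⟩ := he Φ hΦ
  refine ⟨Ψ, h1, fun x => ?_⟩
  have := Ideal.add_mem _ (h2 x) (map_smul_top_mem Φ hΦ _ (h x))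
  rw [map_sub] at this
  simpa using this

lemma good_comp {e e' : P → P} (he : GoodEnd I e) (he' : GoodEnd I e') :
    GoodEnd I (fun x => e (e' x)) := by
  intro Φ hΦ
  obtain ⟨Ψ, h1, h2⟩ := he Φ hΦ
  obtain ⟨Ψ', h1', h2'⟩ := he' Ψ h1
  refine ⟨Ψ', h1', fun x => ?_⟩
  simpa using Ideal.add_mem _ (h2' x) (h2 (e' x))

lemma good_auto (e g : P →ₗ[A] P) (h : ∀ x, e (g x) = x) : GoodEnd I (e : P → P) := by
  intro Φ hΦ
  refine ⟨Φ ∘ₗ e, ?_, fun x => by simp⟩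
  rw [LinearMap.range_comp, LinearMap.range_eq_top.2 (fun x => ⟨g x, h x⟩), Submodule.map_top, hΦ]

end

section
variable {A : Type} [CommRing A] {I : Ideal A} {Q : Type} [AddCommGroup Q] [Module A Q]

lemma good_two (a u : A) (hu : 1 - a * u ∈ I) :
    GoodEnd (A := A) I (fun x : Q × (A × A) => (x.1, (u * x.2.1, u * x.2.2))) := by
  intro Φ hΦ
  have hI : ∀ x, Φ x ∈ I := fun x => hΦ ▸ LinearMap.mem_range_self Φ x
  have hdec : ∀ (q : Q) (x y : A), Φ (q, (x, y)) =
      Φ (q, (0, 0)) + x * Φ (0, (1, 0)) + y * Φ (0, (0, 1)) := by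
    intro q x y
    rw [← smul_eq_mul, ← smul_eq_mul, ← map_smul, ← map_smul, ← map_add, ← map_add]
    simp
  obtain ⟨h, hh⟩ : ∃ h, h = 1 - a * u := ⟨_, rfl⟩
  rw [← hh] at hu
  have hu' := hu
  rw [← hΦ] at hu'
  obtain ⟨⟨q0, x0, y0⟩, h0⟩ := hu'
  rw [hdec] at h0
  obtain ⟨b, hb⟩ : ∃ b, b = Φ (0, (1, 0)) := ⟨_, rfl⟩
  obtain ⟨c, hc⟩ : ∃ c, c = Φ (0, (0, 1)) := ⟨_, rfl⟩
  have hbI : b ∈ I := hb ▸ hI _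
  have hcI : c ∈ I := hc ▸ hI _
  rw [← hb, ← hc] at h0
  simp only [← hb, ← hc] at hdec
  let α := u * (1 + h)
  let b1 := α * b + (h * y0) * h ^ 2
  let b2 := α * c - (h * x0) * h ^ 2
  let Ψ : Q × (A × A) →ₗ[A] A :=
    (Φ ∘ₗ LinearMap.inl A Q (A × A)).coprod
      ((LinearMap.toSpanSingleton A A b1).coprod (LinearMap.toSpanSingleton A A b2))
  have hΨ : ∀ (q : Q) (x y : A), Ψ (q, (x, y)) = Φ (q, (0, 0)) + (x * b1 + y * b2) := by
    intro q x y
    simp [Ψ]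
    rfl
  have hh2 : h ^ 2 ∈ I ^ 2 := Ideal.pow_mem_pow hu 2
  have hhb : h * b ∈ I ^ 2 := by rw [pow_two]; exact Ideal.mul_mem_mul hu hbI
  have hhc : h * c ∈ I ^ 2 := by rw [pow_two]; exact Ideal.mul_mem_mul hu hcI
  have hle : I ^ 2 ≤ I := Ideal.pow_le_self two_ne_zero
  refine ⟨Ψ, le_antisymm ?_ ?_, ?_⟩
  · rintro _ ⟨⟨q, x, y⟩, rfl⟩
    rw [hΨ]
    have e1 : b1 ∈ I := I.add_mem (I.mul_mem_left _ hbI) (I.mul_mem_left _ (hle hh2))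
    have e2 : b2 ∈ I := I.sub_mem (I.mul_mem_left _ hcI) (I.mul_mem_left _ (hle hh2))
    exact I.add_mem (hI _) (I.add_mem (I.mul_mem_left _ e1) (I.mul_mem_left _ e2))
  · obtain ⟨L, hL⟩ : ∃ L : Ideal A, L = LinearMap.range Ψ := ⟨_, rfl⟩
    rw [← hL]
    have m0 : ∀ q, Φ (q, (0, 0)) ∈ L := fun q => by
      rw [hL]; exact ⟨(q, (0, 0)), by rw [hΨ]; ring⟩
    have m1 : b1 ∈ L := by
      rw [hL]; refine ⟨(0, (1, 0)), ?_⟩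
      rw [hΨ, show ((0 : Q), ((0 : A), (0 : A))) = 0 from rfl, map_zero]; ring
    have m2 : b2 ∈ L := by
      rw [hL]; refine ⟨(0, (0, 1)), ?_⟩
      rw [hΨ, show ((0 : Q), ((0 : A), (0 : A))) = 0 from rfl, map_zero]; ring
    let π := Ideal.Quotient.mk L
    have z0 : π (Φ (q0, (0, 0))) = 0 := Ideal.Quotient.eq_zero_iff_mem.2 (m0 _)
    have z1 : π b1 = 0 := Ideal.Quotient.eq_zero_iff_mem.2 m1
    have z2 : π b2 = 0 := Ideal.Quotient.eq_zero_iff_mem.2 m2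
    have zh := congrArg π h0
    have zhh := congrArg π hh
    simp only [map_add, map_mul, z0, map_sub, map_one] at zh zhh
    simp only [b1, b2, map_add, map_mul, map_sub, map_pow] at z1 z2
    obtain ⟨zb, zc⟩ := krus (π a) (π α) (π b) (π c) (π h * π x0) (π h * π y0) (π h ^ 2)
      (by simp only [α, map_mul, map_add, map_one]; linear_combination (π h + 1) * zhh)
      (by linear_combination (-π h) * zh) z1 z2
    have nb := Ideal.Quotient.eq_zero_iff_mem.1 zb
    have nc := Ideal.Quotient.eq_zero_iff_mem.1 zc
    rw [← hΦ]
    rintro _ ⟨⟨q, x, y⟩, rfl⟩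
    rw [hdec]
    exact L.add_mem (L.add_mem (m0 _) (L.mul_mem_left _ nb)) (L.mul_mem_left _ nc)
  · rintro ⟨q, x, y⟩
    simp only
    rw [hΨ, hdec q (u * x) (u * y)]
    have : Φ (q, 0, 0) + (x * b1 + y * b2) - (Φ (q, 0, 0) + u * x * b + u * y * c)
      = (x * u) * (h * b) + (y * u) * (h * c) + (x * h * y0 - y * h * x0) * h ^ 2 := by
      simp only [b1, b2, α]; ring
    rw [this]
    exact Ideal.add_mem _ (Ideal.add_mem _ (Ideal.mul_mem_left _ _ hhb)
      (Ideal.mul_mem_left _ _ hhc)) (Ideal.mul_mem_left _ _ hh2)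

/-- swapping the two copies of `A` -/
lemma good_swap : GoodEnd (A := A) I (fun x : Q × (A × A) => (x.1, (x.2.2, x.2.1))) :=
  good_auto (P := Q × (A × A))
    (LinearMap.id.prodMap ((LinearMap.snd A A A).prod (LinearMap.fst A A A)))
    (LinearMap.id.prodMap ((LinearMap.snd A A A).prod (LinearMap.fst A A A))) (fun x => rfl)

/-- elementary transvection into `Q` -/
def trE (e : Q) : Q × (A × A) →ₗ[A] Q × (A × A) :=
  LinearMap.id + (LinearMap.inl A Q (A × A)) ∘ₗ (LinearMap.toSpanSingleton A Q e) ∘ₗ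
    (LinearMap.snd A A A) ∘ₗ (LinearMap.snd A Q (A × A))

def trF (f : Q →ₗ[A] A) : Q × (A × A) →ₗ[A] Q × (A × A) :=
  LinearMap.id + (LinearMap.inr A Q (A × A)) ∘ₗ (LinearMap.inr A A A) ∘ₗ f ∘ₗ
    (LinearMap.fst A Q (A × A))

lemma trE_apply (e : Q) (x : Q × (A × A)) : trE e x = (x.1 + x.2.2 • e, (x.2.1, x.2.2)) := by
  ext <;> simp [trE]

lemma trF_apply (f : Q →ₗ[A] A) (x : Q × (A × A)) :
    trF f x = (x.1, (x.2.1, x.2.2 + f x.1)) := by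
  ext <;> simp [trF]

lemma good_trE (e : Q) : GoodEnd (A := A) I (trE (A := A) e) :=
  good_auto _ (trE (-e)) (fun x => by simp [trE_apply])

lemma good_trF (f : Q →ₗ[A] A) : GoodEnd (A := A) I (trF f) :=
  good_auto _ (trF (-f)) (fun x => by simp [trF_apply])

lemma smul_mem_prod {d : A} (hd : d ∈ I) (y : Q × (A × A)) :
    d • y ∈ (I • ⊤ : Submodule A (Q × (A × A))) :=
  Submodule.smul_mem_smul hd trivial

/-- scaling `e` and the first copy of `A` -/
lemma good_ea (a u : A) (hu : 1 - a * u ∈ I) (e : Q) (f : Q →ₗ[A] A) (hf : f e - 1 ∈ I) :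
    GoodEnd (A := A) I
      (fun x : Q × (A × A) => (x.1 + ((u - 1) * f x.1) • e, (u * x.2.1, x.2.2))) := by
  have h := good_comp (good_trE (I := I) (A := A) (-e)) (good_comp (good_trF (I := I) f)
    (good_comp (good_trE (I := I) (A := A) (-e)) (good_comp (good_two (Q := Q) a u hu)
    (good_comp (good_trE (I := I) (A := A) e) (good_comp (good_trF (I := I) (-f))
      (good_trE (I := I) (A := A) e))))))
  refine good_congr ?_ h
  rintro ⟨q, x, y⟩
  obtain ⟨d, hd⟩ : ∃ d, d = f e - 1 := ⟨_, rfl⟩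
  rw [← hd] at hf
  have hfe : f e = 1 + d := by rw [hd]; ring
  simp only [trE_apply, trF_apply, map_add, map_smul, map_neg, smul_eq_mul, hfe,
    LinearMap.neg_apply]
  convert smul_mem_prod hf (((-(1 - u) * (y + (-f q - d * y))) • e,
    (0, (-f q - d * y) * (1 - u))) : Q × (A × A)) using 1
  ext
  · simp only [Prod.fst_sub, Prod.smul_fst]
    module
  · simp
  · simp only [Prod.snd_sub, Prod.smul_snd, smul_eq_mul]
    ring

/-- scaling `e` alone by a square -/
lemma good_e (a u : A) (hu : 1 - a * u ∈ I) (e : Q) (f : Q →ₗ[A] A) (hf : f e - 1 ∈ I) :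
    GoodEnd (A := A) I
      (fun x : Q × (A × A) => (x.1 + ((u ^ 2 - 1) * f x.1) • e, x.2)) := by
  have h := good_comp (good_two (I := I) (Q := Q) u a (by rwa [mul_comm]))
    (good_comp (good_ea (I := I) a u hu e f hf) (good_comp (good_swap (I := I))
    (good_comp (good_ea (I := I) a u hu e f hf) (good_swap (I := I)))))
  refine good_congr ?_ h
  rintro ⟨q, x, y⟩
  obtain ⟨d, hd⟩ : ∃ d, d = f e - 1 := ⟨_, rfl⟩
  rw [← hd] at hf
  have hfe : f e = 1 + d := by rw [hd]; ring
  simp only [map_add, map_smul, smul_eq_mul, hfe]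
  convert Submodule.add_mem _
    (smul_mem_prod hf ((((u - 1) ^ 2 * f q) • e, (0, 0)) : Q × (A × A)))
    (smul_mem_prod hu ((0, (-x, -y)) : Q × (A × A))) using 1
  ext
  · simp only [Prod.fst_sub, Prod.smul_fst, Prod.fst_add]
    module
  · simp only [Prod.snd_sub, Prod.smul_snd, Prod.snd_add, Prod.fst_sub, Prod.smul_fst,
      Prod.fst_add, smul_eq_mul]
    ring
  · simp only [Prod.snd_sub, Prod.smul_snd, Prod.snd_add, smul_eq_mul]
    ring

lemma inl_mem {q : Q} (hq : q ∈ (I • ⊤ : Submodule A Q)) :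
    ((q, 0) : Q × (A × A)) ∈ (I • ⊤ : Submodule A (Q × (A × A))) := by
  have h : LinearMap.inl A Q (A × A) q ∈
      Submodule.map (LinearMap.inl A Q (A × A)) (I • ⊤ : Submodule A Q) :=
    Submodule.mem_map_of_mem hq
  rw [Submodule.map_smul''] at h
  exact Submodule.smul_mono le_rfl le_top h

lemma good_sum {ι : Type*} (a u : A) (hu : 1 - a * u ∈ I) (e : ι → Q) (f : ι → Q →ₗ[A] A)
    (hf : ∀ i, f i (e i) - 1 ∈ I) (hf' : ∀ i j, i ≠ j → f i (e j) ∈ I) (S : Finset ι) :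
    GoodEnd (A := A) I
      (fun x : Q × (A × A) => (x.1 + (u ^ 2 - 1) • ∑ i ∈ S, f i x.1 • e i, x.2)) := by
  classical
  induction S using Finset.induction_on with
  | empty =>
    simp only [Finset.sum_empty, smul_zero, add_zero]
    exact good_auto (P := Q × (A × A)) LinearMap.id LinearMap.id (fun _ => rfl)
  | insert j S hj ih =>
    refine good_congr ?_ (good_comp ih (good_e (I := I) a u hu (e j) (f j) (hf j)))
    rintro ⟨q, z⟩
    simp only [Finset.sum_insert hj, map_add, map_smul, smul_eq_mul, add_smul,
      Finset.sum_add_distrib]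
    have key : ∑ i ∈ S, ((u ^ 2 - 1) * f j q * f i (e j)) • e i ∈ (I • ⊤ : Submodule A Q) :=
      Submodule.sum_mem _ fun i hi => Submodule.smul_mem_smul
        (I.mul_mem_left _ (hf' i j (fun h => hj (h ▸ hi)))) trivial
    convert inl_mem (A := A) (Submodule.smul_mem _ (u ^ 2 - 1) key) using 1
    refine Prod.ext ?_ (by simp)
    simp only [Prod.fst_sub]
    module

lemma good_scalar [Module.Finite A Q] [Module.Projective A Q]
    (hfree : Module.Free (A ⧸ I) (Q ⧸ (I • ⊤ : Submodule A Q)))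
    (a u : A) (hu : 1 - a * u ∈ I) :
    GoodEnd (A := A) I (fun x : Q × (A × A) => u ^ 2 • x) := by
  classical
  haveI : Module.Finite (A ⧸ I) (Q ⧸ (I • ⊤ : Submodule A Q)) :=
    Module.Finite.of_restrictScalars_finite A _ _
  let B := Module.Free.chooseBasis (A ⧸ I) (Q ⧸ (I • ⊤ : Submodule A Q))
  choose e he using fun i => Submodule.mkQ_surjective (I • ⊤ : Submodule A Q) (B i)
  choose f hf using fun i => Module.projective_lifting_property (I.mkQ)
    (((B.coord i).restrictScalars A) ∘ₗ Submodule.mkQ (I • ⊤ : Submodule A Q))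
    (Submodule.mkQ_surjective I)
  have hf1 : ∀ i q, Ideal.Quotient.mk I (f i q) =
      B.repr (Submodule.mkQ (I • ⊤ : Submodule A Q) q) i :=
    fun i q => LinearMap.congr_fun (hf i) q
  have h1 := good_sum (I := I) a u hu e f
    (fun i => by
      rw [← Ideal.Quotient.eq_zero_iff_mem, map_sub, hf1, he]; simp)
    (fun i j hij => by
      rw [← Ideal.Quotient.eq_zero_iff_mem, hf1, he]; simp [Ne.symm hij]) Finset.univ
  have hu2 : 1 - a ^ 2 * u ^ 2 ∈ I := by
    have := I.mul_mem_left (1 + a * u) hu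
    convert this using 1
    ring
  refine good_congr ?_ (good_comp (good_two (I := I) (Q := Q) (a ^ 2) (u ^ 2) hu2) h1)
  rintro ⟨q, x, y⟩
  have key : (∑ i, f i q • e i) - q ∈ (I • ⊤ : Submodule A Q) := by
    refine (Submodule.Quotient.mk_eq_zero _).1 ?_
    change Submodule.mkQ (I • ⊤ : Submodule A Q) _ = 0
    rw [map_sub, sub_eq_zero, map_sum]
    rw [← B.sum_repr (Submodule.mkQ (I • ⊤ : Submodule A Q) q)]
    refine Finset.sum_congr rfl fun i _ => ?_
    rw [map_smul, he, ← hf1]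
    rfl
  convert inl_mem (A := A) (Submodule.smul_mem _ (u ^ 2 - 1) key) using 1
  refine Prod.ext ?_ (by simp)
  simp only [Prod.fst_sub, Prod.smul_fst]
  module

end

theorem square_lift
    (A : Type) [CommRing A] [IsNoetherianRing A]
    (I : Ideal A) (s : A) (hs : I ⊔ Ideal.span {s} = ⊤)
    (Q : Type) [AddCommGroup Q] [Module A Q] [Module.Finite A Q] [Module.Projective A Q]
    (hfree : Module.Free (A ⧸ I) (Q ⧸ (I • ⊤ : Submodule A Q)))
    (Φ : Q × (A × A) →ₗ[A] A) (hΦ : LinearMap.range Φ = I)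
    (r : ℕ) (hr : 0 < r) :
    (LinearMap.range (s ^ r • Φ) ⊔ (I ^ 2 : Ideal A) = I) ∧
    (Even r → ∃ Ψ : Q × (A × A) →ₗ[A] A,
      LinearMap.range Ψ = I ∧ ∀ x, Ψ x - s ^ r * Φ x ∈ I ^ 2) := by
  have hinv : ∀ k : ℕ, ∃ a, 1 - a * s ^ k ∈ I := by
    obtain ⟨i, hi, y, hy, hiy⟩ := Submodule.mem_sup.1
      (show (1 : A) ∈ I ⊔ Ideal.span {s} by rw [hs]; trivial)
    obtain ⟨v, rfl⟩ := Ideal.mem_span_singleton'.1 hy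
    intro k
    refine ⟨v ^ k, ?_⟩
    rw [← Ideal.Quotient.eq_zero_iff_mem]
    have h1 := congrArg (Ideal.Quotient.mk I) hiy
    rw [map_add, Ideal.Quotient.eq_zero_iff_mem.2 hi, zero_add, map_one] at h1
    rw [← mul_pow, map_sub, map_pow, h1]
    simp
  refine ⟨?_, ?_⟩
  · apply le_antisymm
    · refine sup_le ?_ (Ideal.pow_le_self two_ne_zero)
      rintro _ ⟨x, rfl⟩
      exact I.mul_mem_left _ (hΦ ▸ LinearMap.mem_range_self Φ x)
    · intro x hx
      obtain ⟨a, ha⟩ := hinv r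
      have hx' := hx
      rw [← hΦ] at hx'
      obtain ⟨p, rfl⟩ := hx'
      refine Submodule.mem_sup.2 ⟨(s ^ r • Φ) (a • p), ⟨_, rfl⟩, (1 - a * s ^ r) * Φ p, ?_, ?_⟩
      · rw [pow_two]; exact Ideal.mul_mem_mul ha hx
      · simp only [LinearMap.smul_apply, map_smul, smul_eq_mul]; ring
  · rintro ⟨k, rfl⟩
    obtain ⟨a, ha⟩ := hinv k
    obtain ⟨Ψ, h1, h2⟩ := good_scalar hfree a (s ^ k) ha Φ hΦ
    refine ⟨Ψ, h1, fun x => ?_⟩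
    have := h2 x
    rw [map_smul, smul_eq_mul] at this
    convert this using 3
    ring
end

section
/- Let B be a commutative Noetherian ring and let I = (c₁, c₂) be an ideal of B generated by two elements. Let b ∈ B be such that I + (b) = B, and let r be a positive even integer. Then there exist e₁, e₂ ∈ B with I = (e₁, e₂), c₁ − e₁ ∈ I², and b^r·c₂ − e₂ ∈ I². -/
open Polynomial TensorProduct

theorem krusemeyer_generators
    (B : Type) [CommRing B] [IsNoetherianRing B]
    (c₁ c₂ b : B) (I : Ideal B) (hI : I = Ideal.span {c₁, c₂})
    (hb : I ⊔ Ideal.span {b} = ⊤)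
    (r : ℕ) (hr : 0 < r) (hre : Even r) :
    ∃ e₁ e₂ : B, I = Ideal.span {e₁, e₂} ∧ c₁ - e₁ ∈ I ^ 2 ∧ b ^ r * c₂ - e₂ ∈ I ^ 2 := by
  obtain ⟨k, rfl⟩ := hre
  obtain ⟨a, ha⟩ : ∃ a, a = b ^ k := ⟨_, rfl⟩
  have hcop : IsCoprime I (Ideal.span {a}) := by
    rw [ha, ← Ideal.span_singleton_pow]
    exact (Ideal.isCoprime_iff_sup_eq.mpr hb).pow_right
  obtain ⟨t, htI, s, hs, hts⟩ := Ideal.isCoprime_iff_exists.mp hcop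
  obtain ⟨p, rfl⟩ := Ideal.mem_span_singleton'.mp hs
  have htI' := htI
  rw [hI] at htI'
  obtain ⟨y, z, ht⟩ := Ideal.mem_span_pair.mp htI'
  have h1 : c₁ ∈ I := hI ▸ Ideal.subset_span (by simp)
  have h2 : c₂ ∈ I := hI ▸ Ideal.subset_span (by simp)
  have tt : t * t ∈ I ^ 2 := by rw [pow_two]; exact Ideal.mul_mem_mul htI htI
  have t1 : t * c₁ ∈ I ^ 2 := by rw [pow_two]; exact Ideal.mul_mem_mul htI h1
  have t2 : t * c₂ ∈ I ^ 2 := by rw [pow_two]; exact Ideal.mul_mem_mul htI h2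
  have hpa : p * a = 1 - t := by linear_combination hts
  obtain ⟨f₁, hf1⟩ : ∃ f, f = a * c₁ - z * t ^ 2 := ⟨_, rfl⟩
  obtain ⟨f₂, hf2⟩ : ∃ f, f = a * c₂ + y * t ^ 2 := ⟨_, rfl⟩
  obtain ⟨e₁, he1⟩ : ∃ f, f = p * (1 + t) * f₁ - t * f₂ := ⟨_, rfl⟩
  obtain ⟨e₂, he2⟩ : ∃ f, f = t * f₁ + a * f₂ := ⟨_, rfl⟩
  have d1 : c₁ - e₁ ∈ I ^ 2 := by
    have : c₁ - e₁ = t * (t * c₁) + (p * (1 + t) * z + t * y) * (t * t) + a * (t * c₂) := by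
      rw [he1, hf1, hf2]; linear_combination (-(1 + t) * c₁) * hpa
    rw [this]
    exact add_mem (add_mem (Ideal.mul_mem_left _ _ t1) (Ideal.mul_mem_left _ _ tt))
      (Ideal.mul_mem_left _ _ t2)
  have d2 : b ^ (k + k) * c₂ - e₂ ∈ I ^ 2 := by
    have : b ^ (k + k) * c₂ - e₂ = (-a) * (t * c₁) + (z * t - a * y) * (t * t) := by
      rw [he2, hf1, hf2, pow_add, ← ha]; ring
    rw [this]
    exact add_mem (Ideal.mul_mem_left _ _ t1) (Ideal.mul_mem_left _ _ tt)
  refine ⟨e₁, e₂, ?_, d1, d2⟩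
  have hle : I ^ 2 ≤ I := Ideal.pow_le_self two_ne_zero
  apply le_antisymm
  · set J := Ideal.span {e₁, e₂} with hJ
    have m1 : e₁ ∈ J := Ideal.subset_span (by simp)
    have m2 : e₂ ∈ J := Ideal.subset_span (by simp)
    have k1 : f₁ ∈ J := by
      have : f₁ = a * e₁ + t * e₂ := by
        rw [he1, he2]; linear_combination (-(1 + t) * f₁) * hpa
      rw [this]; exact add_mem (Ideal.mul_mem_left _ _ m1) (Ideal.mul_mem_left _ _ m2)
    have k2 : f₂ ∈ J := by
      have : f₂ = (-t) * e₁ + p * (1 + t) * e₂ := by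
        rw [he1, he2]; linear_combination (-(1 + t) * f₂) * hpa
      rw [this]; exact add_mem (Ideal.mul_mem_left _ _ m1) (Ideal.mul_mem_left _ _ m2)
    have hat : a * t ∈ J := by
      have : a * t = y * f₁ + z * f₂ := by
        rw [hf1, hf2]; linear_combination (-a) * ht
      rw [this]; exact add_mem (Ideal.mul_mem_left _ _ k1) (Ideal.mul_mem_left _ _ k2)
    have ht3 : t ^ 3 ∈ J := by
      have : t ^ 3 = (-c₂) * f₁ + c₁ * f₂ := by
        rw [hf1, hf2]; linear_combination (-t ^ 2) * ht
      rw [this]; exact add_mem (Ideal.mul_mem_left _ _ k1) (Ideal.mul_mem_left _ _ k2)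
    have htJ : t ∈ J := by
      have : t = (p * (1 + t)) * (a * t) + t ^ 3 := by
        linear_combination (-(1 + t) * t) * hpa
      rw [this]; exact add_mem (Ideal.mul_mem_left _ _ hat) ht3
    rw [hI, Ideal.span_le]
    rintro x (rfl | rfl)
    · have : x = p * f₁ + (x + p * z * t) * t := by
        rw [hf1]; linear_combination (-x) * hpa
      rw [this]; exact add_mem (Ideal.mul_mem_left _ _ k1) (Ideal.mul_mem_left _ _ htJ)
    · have : x = p * f₂ + (x - p * y * t) * t := by
        rw [hf2]; linear_combination (-x) * hpa
      rw [this]; exact add_mem (Ideal.mul_mem_left _ _ k2) (Ideal.mul_mem_left _ _ htJ)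
  · rw [Ideal.span_le]
    rintro x (rfl | rfl)
    · have := sub_mem h1 (hle d1)
      rwa [sub_sub_cancel] at this
    · have := sub_mem (Ideal.mul_mem_left _ (b ^ (k + k)) h2) (hle d2)
      rwa [sub_sub_cancel] at this
end
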